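/- Let X be a finite nonempty set, ν a probability measure on X, α ∈ (0,1), and f : X → ℝ. Define c_α(u) = [ α(1−u)log(1−u) − (1−αu)log(1−αu) ] / ( α(1−α) ) for u ∈ [0,1], and R̃^α f(x) = inf over probability measures p on X of ( ∑_y f(y)p(y) + c_α( ∑_{y≠x} p(y) ) ). Then ( ∑_x exp(α·R̃^α f(x)) ν(x) )^{1/α} · ( ∑_x exp(−(1−α)f(x)) ν(x) )^{1/(1−α)} ≤ 1. Moreover, c_α(u) ≥ u²/2 for all u ∈ [0,1], so the same inequality holds with R̃^α f replaced by R̃f(x) = inf over probability measures p on X of ( ∑_y f(y)p(y) + (1/2)( ∑_{y≠x} p(y) )² ). -/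

import Mathlib

attribute [local instance] Classical.propDecidable

noncomputable section

/-- The cost function `c_α`. -/
noncomputable def calpha (α u : ℝ) : ℝ :=
  (α * (1 - u) * Real.log (1 - u) - (1 - α * u) * Real.log (1 - α * u)) / (α * (1 - α))

/-- The infimum-convolution operator `R̃^α f`. -/
noncomputable def Rtilde {X : Type*} [Fintype X] (α : ℝ) (f : X → ℝ) (x : X) : ℝ :=
  sInf {w | ∃ p : X → ℝ, (∀ y, 0 ≤ p y) ∧ (∑ y, p y = 1) ∧
    w = (∑ y, f y * p y) + calpha α (∑ y ∈ Finset.univ.filter (fun y => y ≠ x), p y)}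

/-- The infimum-convolution operator `R̃ f` with quadratic cost. -/
noncomputable def Rsq {X : Type*} [Fintype X] (f : X → ℝ) (x : X) : ℝ :=
  sInf {w | ∃ p : X → ℝ, (∀ y, 0 ≤ p y) ∧ (∑ y, p y = 1) ∧
    w = (∑ y, f y * p y) + (∑ y ∈ Finset.univ.filter (fun y => y ≠ x), p y) ^ 2 / 2}

theorem calpha_zero (α : ℝ) : calpha α 0 = 0 := by simp [calpha]

theorem continuous_calpha (α : ℝ) : Continuous (calpha α) := by
  have h₁ : Continuous fun u : ℝ => (1 - u) * Real.log (1 - u) :=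
    Real.continuous_mul_log.comp (continuous_const.sub continuous_id)
  have h₂ : Continuous fun u : ℝ => (1 - α * u) * Real.log (1 - α * u) :=
    Real.continuous_mul_log.comp (continuous_const.sub (continuous_const.mul continuous_id))
  have h₃ := ((continuous_const (y := α)).mul h₁ |>.sub h₂).div_const (α * (1 - α))
  refine h₃.congr fun u => ?_
  simp only [calpha, Pi.sub_apply, Pi.mul_apply]
  ring

theorem hasDerivAt_calpha {α u : ℝ} (hα₀ : α ≠ 0) (hα₁ : 1 - α ≠ 0) (hu : 1 - u ≠ 0)
    (hαu : 1 - α * u ≠ 0) :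
    HasDerivAt (calpha α) ((Real.log (1 - α * u) - Real.log (1 - u)) / (1 - α)) u := by
  have h₁ : HasDerivAt (fun v : ℝ => 1 - v) (-1) u := by
    simpa using (hasDerivAt_id u).const_sub 1
  have h₂ : HasDerivAt (fun v : ℝ => 1 - α * v) (-α) u := by
    simpa using ((hasDerivAt_id u).const_mul α).const_sub 1
  have h₃ := (((h₁.const_mul α).mul (h₁.log hu)).sub (h₂.mul (h₂.log hαu))).div_const
    (α * (1 - α))
  refine h₃.congr_deriv ?_
  field_simp
  ring

theorem sq_div_two_le_calpha {α u : ℝ} (hα : α ∈ Set.Ioo (0 : ℝ) 1) (hu : u ∈ Set.Icc (0 : ℝ) 1) :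
    u ^ 2 / 2 ≤ calpha α u := by
  obtain ⟨hα₀, hα₁⟩ := hα
  have hderiv : ∀ v ∈ Set.Ioo (0 : ℝ) 1, HasDerivAt (fun w => calpha α w - w ^ 2 / 2)
      ((Real.log (1 - α * v) - Real.log (1 - v)) / (1 - α) - v) v := by
    rintro v ⟨hv₀, hv₁⟩
    have hsq : HasDerivAt (fun w : ℝ => w ^ 2 / 2) v v :=
      ((hasDerivAt_pow 2 v).div_const 2).congr_deriv (by norm_num)
    exact (hasDerivAt_calpha hα₀.ne' (by linarith) (by linarith) (by nlinarith)).sub hsq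
  have hmono : MonotoneOn (fun w => calpha α w - w ^ 2 / 2) (Set.Icc 0 1) := by
    refine monotoneOn_of_deriv_nonneg (convex_Icc 0 1) ?_ ?_ ?_
    · exact ((continuous_calpha α).sub (by fun_prop)).continuousOn
    · rw [interior_Icc]
      exact fun v hv => (hderiv v hv).differentiableAt.differentiableWithinAt
    · rw [interior_Icc]
      intro v hv
      rw [(hderiv v hv).deriv]
      obtain ⟨hv₀, hv₁⟩ := hv
      have hpos : 0 < 1 - α * v := by nlinarith
      have hlog := Real.log_le_sub_one_of_pos (div_pos (sub_pos.2 hv₁) hpos)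
      rw [Real.log_div (by linarith) hpos.ne'] at hlog
      have hratio : (1 - v) / (1 - α * v) ≤ 1 - (1 - α) * v := by
        rw [div_le_iff₀ hpos]
        nlinarith [mul_pos (mul_pos hα₀ (sub_pos.2 hα₁)) (mul_pos hv₀ hv₀)]
      rw [sub_nonneg, le_div_iff₀ (by linarith)]
      linarith
  have h := hmono (Set.left_mem_Icc.2 zero_le_one) hu hu.1
  simp only [calpha_zero] at h
  linarith

section

variable {X : Type*} [Fintype X]

theorem sum_filter_ne_eq_one_sub {p : X → ℝ} (hp : ∑ y, p y = 1) (x : X) :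
    ∑ y ∈ Finset.univ.filter (fun y => y ≠ x), p y = 1 - p x := by
  rw [← hp, Finset.filter_ne', ← Finset.sum_erase_add _ _ (Finset.mem_univ x)]
  ring

theorem sum_filter_ne_mem_Icc {p : X → ℝ} (hp₀ : ∀ y, 0 ≤ p y) (hp₁ : ∑ y, p y = 1) (x : X) :
    ∑ y ∈ Finset.univ.filter (fun y => y ≠ x), p y ∈ Set.Icc (0 : ℝ) 1 := by
  refine ⟨Finset.sum_nonneg fun y _ => hp₀ y, ?_⟩
  rw [sum_filter_ne_eq_one_sub hp₁]
  linarith [hp₀ x]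

theorem le_sum_mul {f p : X → ℝ} {m : ℝ} (hm : ∀ y, m ≤ f y) (hp₀ : ∀ y, 0 ≤ p y)
    (hp₁ : ∑ y, p y = 1) : m ≤ ∑ y, f y * p y :=
  calc m = ∑ y, m * p y := by rw [← Finset.mul_sum, hp₁, mul_one]
    _ ≤ ∑ y, f y * p y :=
      Finset.sum_le_sum fun y _ => mul_le_mul_of_nonneg_right (hm y) (hp₀ y)

theorem Rsq_le_Rtilde [Nonempty X] {α : ℝ} (hα : α ∈ Set.Ioo (0 : ℝ) 1) (f : X → ℝ) (x : X) :
    Rsq f x ≤ Rtilde α f x := by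
  obtain ⟨z, hz⟩ := Finite.exists_min f
  refine le_csInf ⟨_, Pi.single x 1, fun y => ?_, by simp, rfl⟩ ?_
  · exact (Pi.single_nonneg.2 zero_le_one : (0 : X → ℝ) ≤ Pi.single x 1) y
  · rintro w ⟨p, hp₀, hp₁, rfl⟩
    refine le_trans (csInf_le ⟨f z, ?_⟩ ⟨p, hp₀, hp₁, rfl⟩)
      (add_le_add le_rfl (sq_div_two_le_calpha hα (sum_filter_ne_mem_Icc hp₀ hp₁ x)))
    rintro w ⟨q, hq₀, hq₁, rfl⟩
    linarith [le_sum_mul hz hq₀ hq₁,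
      sq_nonneg (∑ y ∈ Finset.univ.filter (fun y => y ≠ x), q y)]

theorem Rtilde_le {α : ℝ} (hα : α ∈ Set.Ioo (0 : ℝ) 1) {f : X → ℝ} {z : X}
    (hz : ∀ y, f z ≤ f y) (x : X) {u : ℝ} (hu : u ∈ Set.Icc (0 : ℝ) 1) (hxu : x = z → u = 0) :
    Rtilde α f x ≤ (1 - u) * f x + u * f z + calpha α u := by
  refine csInf_le ⟨f z, ?_⟩ ?_
  · rintro w ⟨q, hq₀, hq₁, rfl⟩
    have h := sq_div_two_le_calpha hα (sum_filter_ne_mem_Icc hq₀ hq₁ x)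
    linarith [le_sum_mul hz hq₀ hq₁,
      sq_nonneg (∑ y ∈ Finset.univ.filter (fun y => y ≠ x), q y)]
  · have hsum : ∑ y, ((if y = x then 1 - u else 0) + if y = z then u else 0) = 1 := by
      simp [Finset.sum_add_distrib]
    refine ⟨fun y => (if y = x then 1 - u else 0) + if y = z then u else 0, fun y => ?_, hsum, ?_⟩
    · have := hu.1
      have := sub_nonneg.2 hu.2
      positivity
    · rw [sum_filter_ne_eq_one_sub hsum]
      have hu' : (if x = z then u else 0) = 0 := by
        split_ifs with h
        · exact hxu h
        · rfl
      simp only [mul_add, Finset.sum_add_distrib, mul_ite, mul_zero, Finset.sum_ite_eq',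
        Finset.mem_univ, if_true, hu', add_zero, sub_sub_cancel]
      ring

/-- Evaluating the cost at its critical point `u = (s - 1) / (s - α)`, where
`s = exp ((1 - α) g)`. -/
theorem one_sub_mul_add_calpha {α s : ℝ} (hα : α ∈ Set.Ioo (0 : ℝ) 1) (hs : 1 ≤ s) :
    (1 - (s - 1) / (s - α)) * (Real.log s / (1 - α)) + calpha α ((s - 1) / (s - α)) =
      -Real.log (s * (1 - α) / (s - α)) / α := by
  obtain ⟨hα₀, hα₁⟩ := hα
  have hsα : s - α ≠ 0 := by linarith
  have hα' : 1 - α ≠ 0 := by linarith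
  have hs₀ : s ≠ 0 := by linarith
  have h₁ : 1 - (s - 1) / (s - α) = (1 - α) / (s - α) := by
    field_simp
    ring
  have h₂ : 1 - α * ((s - 1) / (s - α)) = s * ((1 - α) / (s - α)) := by
    field_simp
    ring
  rw [calpha, h₁, h₂, mul_div_assoc s, Real.log_mul hs₀ (div_ne_zero hα' hsα)]
  generalize Real.log ((1 - α) / (s - α)) = l
  field_simp
  ring

theorem exp_Rtilde_add_exp_le_one {α : ℝ} (hα : α ∈ Set.Ioo (0 : ℝ) 1) {f : X → ℝ} {z : X}
    (hz : ∀ y, f z ≤ f y) (x : X) :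
    (1 - α) * Real.exp (α * (Rtilde α f x - f z)) + α * Real.exp (-(1 - α) * (f x - f z)) ≤ 1 := by
  obtain ⟨hα₀, hα₁⟩ := id hα
  set s := Real.exp ((1 - α) * (f x - f z)) with hs
  have hα' : 0 < 1 - α := by linarith
  have hs₁ : 1 ≤ s := Real.one_le_exp (mul_nonneg hα'.le (sub_nonneg.2 (hz x)))
  have hs₀ : 0 < s := by linarith
  have hsα : 0 < s - α := by linarith
  have hlog : Real.log s / (1 - α) = f x - f z := by
    rw [hs, Real.log_exp]
    field_simp
  have hR := Rtilde_le hα hz x (u := (s - 1) / (s - α))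
    ⟨div_nonneg (by linarith) hsα.le, (div_le_one hsα).2 (by linarith)⟩
    (fun h => by simp [hs, h])
  have hval := one_sub_mul_add_calpha hα hs₁
  rw [hlog] at hval
  have hle : Rtilde α f x - f z ≤ -Real.log (s * (1 - α) / (s - α)) / α := by linarith
  have hexp : Real.exp (α * (Rtilde α f x - f z)) ≤ (s - α) / (s * (1 - α)) := by
    rw [le_div_iff₀ hα₀, mul_comm, ← Real.log_inv, inv_div] at hle
    exact (Real.exp_le_exp.2 hle).trans_eq (Real.exp_log (by positivity))
  have hneg : Real.exp (-(1 - α) * (f x - f z)) = 1 / s := by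
    rw [neg_mul, Real.exp_neg, one_div]
  rw [hneg]
  calc (1 - α) * Real.exp (α * (Rtilde α f x - f z)) + α * (1 / s)
      ≤ (1 - α) * ((s - α) / (s * (1 - α))) + α * (1 / s) := by gcongr
    _ = 1 := by
      field_simp
      ring

theorem rpow_mul_rpow_le_one {α a b : ℝ} (hα : α ∈ Set.Ioo (0 : ℝ) 1) (ha : 0 ≤ a) (hb : 0 ≤ b)
    (hab : (1 - α) * a + α * b ≤ 1) : a ^ (1 / α) * b ^ (1 / (1 - α)) ≤ 1 := by
  obtain ⟨hα₀, hα₁⟩ := hα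
  have hα' : 0 < 1 - α := by linarith
  have h := (Real.geom_mean_le_arith_mean2_weighted hα'.le hα₀.le ha hb (by ring)).trans hab
  have h' := Real.rpow_le_one (by positivity) h (z := 1 / (α * (1 - α))) (by positivity)
  rw [Real.mul_rpow (by positivity) (by positivity), ← Real.rpow_mul ha, ← Real.rpow_mul hb] at h'
  convert h' using 3 <;> field_simp

theorem infConvolution_le_one_of_le_Rtilde [Nonempty X] {ν : X → ℝ} (hν₁ : ∀ x, 0 ≤ ν x)
    (hν₂ : ∑ x, ν x = 1) {α : ℝ} (hα : α ∈ Set.Ioo (0 : ℝ) 1) {f R : X → ℝ}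
    (hR : ∀ x, R x ≤ Rtilde α f x) :
    (∑ x, Real.exp (α * R x) * ν x) ^ ((1 : ℝ) / α) *
      (∑ x, Real.exp (-(1 - α) * f x) * ν x) ^ ((1 : ℝ) / (1 - α)) ≤ 1 := by
  obtain ⟨hα₀, hα₁⟩ := id hα
  have hα' : 0 < 1 - α := by linarith
  obtain ⟨z, hz⟩ := Finite.exists_min f
  set a := ∑ x, Real.exp (α * (R x - f z)) * ν x
  set b := ∑ x, Real.exp (-(1 - α) * (f x - f z)) * ν x
  have ha : 0 ≤ a := Finset.sum_nonneg fun x _ => mul_nonneg (Real.exp_nonneg _) (hν₁ x)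
  have hb : 0 ≤ b := Finset.sum_nonneg fun x _ => mul_nonneg (Real.exp_nonneg _) (hν₁ x)
  have hab : (1 - α) * a + α * b ≤ 1 := by
    rw [Finset.mul_sum, Finset.mul_sum, ← Finset.sum_add_distrib]
    refine (Finset.sum_le_sum fun x _ => ?_).trans_eq hν₂
    have hx : (1 - α) * Real.exp (α * (R x - f z)) + α * Real.exp (-(1 - α) * (f x - f z)) ≤ 1 := by
      refine le_trans ?_ (exp_Rtilde_add_exp_le_one hα hz x)
      gcongr
      exact hR x
    linarith [mul_le_mul_of_nonneg_right hx (hν₁ x)]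
  have hA : ∑ x, Real.exp (α * R x) * ν x = Real.exp (f z * α) * a := by
    rw [Finset.mul_sum]
    refine Finset.sum_congr rfl fun x _ => ?_
    rw [← mul_assoc, ← Real.exp_add]
    ring_nf
  have hB : ∑ x, Real.exp (-(1 - α) * f x) * ν x = Real.exp (-f z * (1 - α)) * b := by
    rw [Finset.mul_sum]
    refine Finset.sum_congr rfl fun x _ => ?_
    rw [← mul_assoc, ← Real.exp_add]
    ring_nf
  have key := rpow_mul_rpow_le_one hα ha hb hab
  rw [hA, hB, Real.mul_rpow (Real.exp_nonneg _) ha, Real.mul_rpow (Real.exp_nonneg _) hb,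
    ← Real.exp_mul, ← Real.exp_mul, mul_assoc (f z), mul_assoc (-f z), mul_one_div_cancel hα₀.ne',
    mul_one_div_cancel hα'.ne', mul_one, mul_one, mul_mul_mul_comm, ← Real.exp_add,
    add_neg_cancel, Real.exp_zero, one_mul]
  exact key

end

/-- The infimum-convolution inequality of Lemma `completegraph`. -/
theorem stmt16 {X : Type*} [Fintype X] [Nonempty X]
    (ν : X → ℝ) (hν₁ : ∀ x, 0 ≤ ν x) (hν₂ : ∑ x, ν x = 1)
    (α : ℝ) (hα : α ∈ Set.Ioo (0 : ℝ) 1) (f : X → ℝ) :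
    ((∑ x, Real.exp (α * Rtilde α f x) * ν x) ^ ((1 : ℝ) / α) *
      (∑ x, Real.exp (-(1 - α) * f x) * ν x) ^ ((1 : ℝ) / (1 - α)) ≤ 1) ∧
    (∀ u ∈ Set.Icc (0 : ℝ) 1, u ^ 2 / 2 ≤ calpha α u) ∧
    ((∑ x, Real.exp (α * Rsq f x) * ν x) ^ ((1 : ℝ) / α) *
      (∑ x, Real.exp (-(1 - α) * f x) * ν x) ^ ((1 : ℝ) / (1 - α)) ≤ 1) := by
  exact ⟨infConvolution_le_one_of_le_Rtilde hν₁ hν₂ hα fun _ => le_rfl,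
    fun _ hu => sq_div_two_le_calpha hα hu,
    infConvolution_le_one_of_le_Rtilde hν₁ hν₂ hα (Rsq_le_Rtilde hα f)⟩

end
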